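/- arXiv:1402.2520 — 5 statements merged into one kernel-verified Lean document; each statement's English description precedes it below -/
import Mathlib

section
/- Let n, m be positive integers and let 1 ≤ k ≤ m. For every x ∈ [(k-1)/m, k/m], the second moment of the composite Bernstein operator satisfies B̄_{n,m}((e₁ - x)²; x) = (x - (k-1)/m)·(k/m - x)/n, where e₁(t) = t. -/
open Set Finset

noncomputable section

/-- The Bernstein polynomial of degree `n` associated to `f` on the
subinterval `[(k-1)/m, k/m]`. -/
def bernsteinPiece (n m k : ℕ) (f : ℝ → ℝ) (x : ℝ) : ℝ :=
  (m : ℝ) ^ n * ∑ i ∈ Finset.range (n + 1),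
    (n.choose i : ℝ) * (x - ((k : ℝ) - 1) / (m : ℝ)) ^ i * ((k : ℝ) / (m : ℝ) - x) ^ (n - i) *
      f (((k : ℝ) * n - n + i) / ((m : ℝ) * n))

/-- The index `k` (with `1 ≤ k ≤ m`) such that `x` belongs to the piece `[(k-1)/m, k/m]`. -/
def pieceIdx (m : ℕ) (x : ℝ) : ℕ := min m (⌊(m : ℝ) * x⌋.toNat + 1)

/-- The composite Bernstein operator `B̄_{n,m}`. -/
def compBernstein (n m : ℕ) (f : ℝ → ℝ) : ℝ → ℝ := fun x =>
  bernsteinPiece n m (pieceIdx m x) f x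

theorem sum_sq_sub_mul_bernstein (n : ℕ) (y : ℝ) :
    ∑ i ∈ Finset.range (n + 1),
      ((n : ℝ) * y - i) ^ 2 * ((n.choose i : ℝ) * y ^ i * (1 - y) ^ (n - i)) =
      n * y * (1 - y) := by
  have h := congrArg (Polynomial.eval y) (bernsteinPolynomial.variance ℝ n)
  simpa [Polynomial.eval_finsetSum, bernsteinPolynomial] using h

theorem second_moment_bernsteinPiece (n m k : ℕ) (hn : 0 < n) (hm : 0 < m) (x : ℝ) :
    bernsteinPiece n m k (fun t => (t - x) ^ 2) x =
      (x - ((k : ℝ) - 1) / (m : ℝ)) * ((k : ℝ) / (m : ℝ) - x) / (n : ℝ) := by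
  have hn' : (n : ℝ) ≠ 0 := by positivity
  have hm' : (m : ℝ) ≠ 0 := by positivity
  obtain ⟨y, rfl⟩ : ∃ y : ℝ, x = (y + ((k : ℝ) - 1)) / m :=
    ⟨m * x - ((k : ℝ) - 1), by field_simp; ring⟩
  have hl : (y + ((k : ℝ) - 1)) / m - ((k : ℝ) - 1) / m = y / m := by ring
  have hr : (k : ℝ) / m - (y + ((k : ℝ) - 1)) / m = (1 - y) / m := by ring
  have hsum : bernsteinPiece n m k (fun t => (t - (y + ((k : ℝ) - 1)) / m) ^ 2)
      ((y + ((k : ℝ) - 1)) / m) =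
      (∑ i ∈ Finset.range (n + 1),
        ((n : ℝ) * y - i) ^ 2 * ((n.choose i : ℝ) * y ^ i * (1 - y) ^ (n - i))) /
        ((m : ℝ) * n) ^ 2 := by
    rw [bernsteinPiece, Finset.mul_sum, Finset.sum_div]
    refine Finset.sum_congr rfl fun i hi => ?_
    have hpow : (m : ℝ) ^ n = (m : ℝ) ^ i * (m : ℝ) ^ (n - i) := by
      rw [← pow_add, Nat.add_sub_cancel' (Nat.lt_succ_iff.mp (Finset.mem_range.mp hi))]
    have hnode : ((k : ℝ) * n - n + i) / ((m : ℝ) * n) - (y + ((k : ℝ) - 1)) / m =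
        -((n : ℝ) * y - i) / ((m : ℝ) * n) := by
      field_simp
      ring
    rw [hl, hr, hnode, hpow, div_pow y, div_pow (1 - y), div_pow (-_), neg_sq]
    field_simp
  rw [hsum, sum_sq_sub_mul_bernstein, hl, hr]
  field_simp

theorem pieceIdx_eq_or (m k : ℕ) (hm : 0 < m) (hk1 : 1 ≤ k) (hk2 : k ≤ m) (x : ℝ)
    (hx : x ∈ Set.Icc (((k : ℝ) - 1) / (m : ℝ)) ((k : ℝ) / (m : ℝ))) :
    pieceIdx m x = k ∨ pieceIdx m x = k + 1 ∧ x = (k : ℝ) / m := by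
  have hm' : (0 : ℝ) < m := by positivity
  obtain ⟨hlo, hhi⟩ := hx
  rw [div_le_iff₀' hm'] at hlo
  rcases hhi.lt_or_eq with hlt | heq
  · left
    rw [lt_div_iff₀' hm'] at hlt
    have hfloor : ⌊(m : ℝ) * x⌋ = (k : ℤ) - 1 := by
      rw [Int.floor_eq_iff]
      push_cast
      constructor <;> linarith
    rw [pieceIdx, hfloor]
    omega
  · have hfloor : ⌊(m : ℝ) * x⌋ = (k : ℤ) := by
      rw [heq, mul_div_cancel₀ _ hm'.ne', Int.floor_natCast]
    rw [pieceIdx, hfloor, Int.toNat_natCast]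
    rcases hk2.lt_or_eq with h | h
    · exact Or.inr ⟨by omega, heq⟩
    · exact Or.inl (by omega)

theorem second_moment_compBernstein
    (n m : ℕ) (hn : 0 < n) (hm : 0 < m) (k : ℕ) (hk1 : 1 ≤ k) (hk2 : k ≤ m)
    (x : ℝ) (hx : x ∈ Set.Icc (((k : ℝ) - 1) / (m : ℝ)) ((k : ℝ) / (m : ℝ))) :
    compBernstein n m (fun t => (t - x) ^ 2) x =
      (x - ((k : ℝ) - 1) / (m : ℝ)) * ((k : ℝ) / (m : ℝ) - x) / (n : ℝ) := by
  rw [compBernstein, second_moment_bernsteinPiece n m _ hn hm]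
  rcases pieceIdx_eq_or m k hm hk1 hk2 x hx with h | ⟨h, hxk⟩
  · rw [h]
  · rw [h, hxk]
    push_cast
    ring
end
end

section
/- If L : C[0,1] → C[0,1] is a positive linear operator which reproduces all affine (linear) functions, then for every f ∈ C[0,1], every x ∈ [0,1] and every h > 0, one has |L(f; x) - f(x)| ≤ [1 + (1/(2h²))·L((e₁ - x)²; x)]·ω₂(f; h), where e₁(t) = t. -/
open Set Finset

noncomputable section

/-- The unit interval `[0,1]` as a set. -/
abbrev I01 : Set ℝ := Set.Icc (0 : ℝ) 1

/-- Second order modulus of smoothness for a continuous function on `[0,1]`. -/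
def omega2I (f : C(I01, ℝ)) (δ : ℝ) : ℝ :=
  sSup {v | ∃ x h : ℝ, ∃ hx : x ∈ I01, ∃ h1 : x - h ∈ I01, ∃ h2 : x + h ∈ I01,
    |h| ≤ δ ∧ v = |f ⟨x - h, h1⟩ - 2 * f ⟨x, hx⟩ + f ⟨x + h, h2⟩|}

theorem bddAbove_secondDifferences (f : C(I01, ℝ)) (δ : ℝ) :
    BddAbove {v | ∃ x h : ℝ, ∃ hx : x ∈ I01, ∃ h1 : x - h ∈ I01, ∃ h2 : x + h ∈ I01,
      |h| ≤ δ ∧ v = |f ⟨x - h, h1⟩ - 2 * f ⟨x, hx⟩ + f ⟨x + h, h2⟩|} := by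
  refine ⟨4 * ‖f‖, ?_⟩
  rintro v ⟨x, h, hx, h1, h2, -, rfl⟩
  have e1 := abs_le.1 (f.norm_coe_le_norm ⟨x - h, h1⟩)
  have e2 := abs_le.1 (f.norm_coe_le_norm ⟨x, hx⟩)
  have e3 := abs_le.1 (f.norm_coe_le_norm ⟨x + h, h2⟩)
  rw [abs_le]
  constructor <;> linarith [e1.1, e1.2, e2.1, e2.2, e3.1, e3.2]

theorem omega2I_nonneg (f : C(I01, ℝ)) (δ : ℝ) : 0 ≤ omega2I f δ := by
  apply Real.sSup_nonneg
  rintro v ⟨x, h, hx, h1, h2, -, rfl⟩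
  exact abs_nonneg _

theorem omega2I_neg (f : C(I01, ℝ)) (δ : ℝ) : omega2I (-f) δ = omega2I f δ := by
  unfold omega2I
  congr 1
  ext v
  have key : ∀ p q r : ℝ, |-p - 2 * -q + -r| = |p - 2 * q + r| := fun p q r => by
    rw [← abs_neg]; ring_nf
  simp only [ContinuousMap.neg_apply, key]

theorem secondDifference_le_omega2I (f : C(I01, ℝ)) {δ y η : ℝ} (hη : |η| ≤ δ)
    (hy : y ∈ I01) (h1 : y - η ∈ I01) (h2 : y + η ∈ I01) :
    f ⟨y - η, h1⟩ - 2 * f ⟨y, hy⟩ + f ⟨y + η, h2⟩ ≤ omega2I f δ :=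
  (le_abs_self _).trans
    (le_csSup (bddAbove_secondDifferences f δ) ⟨y, η, hy, h1, h2, hη, rfl⟩)

/-- A maximum principle: apply the second difference bound at the leftmost maximum of `w`, with
step the distance to the nearest endpoint or `h`, whichever is smaller. -/
theorem le_of_secondDifference_le {w : ℝ → ℝ} {a b h ω : ℝ} (hh : 0 < h) (hω : 0 ≤ ω)
    (hw : ContinuousOn w (Icc a b)) (ha : w a = 0) (hb : w b = 0)
    (hd : ∀ y η, 0 ≤ η → η ≤ h → a ≤ y - η → y + η ≤ b →
      2 * w y - w (y - η) - w (y + η) ≤ (1 - η ^ 2 / h ^ 2) * ω)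
    {x : ℝ} (hx : x ∈ Icc a b) : w x ≤ ω := by
  obtain ⟨m, hm, hmax⟩ := isCompact_Icc.exists_isMaxOn ⟨x, hx⟩ hw
  have hmax' : ∀ t ∈ Icc a b, w t ≤ w m := fun t ht => hmax ht
  have hcl : IsClosed (Icc a b ∩ w ⁻¹' {w m}) :=
    hw.preimage_isClosed_of_isClosed isClosed_Icc isClosed_singleton
  obtain ⟨y, ⟨hy, hyw⟩, hleast⟩ :=
    (isCompact_Icc.of_isClosed_subset hcl inter_subset_left).exists_isLeast ⟨m, hm, rfl⟩
  have hyw : w y = w m := hyw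
  refine (hmax' x hx).trans ?_
  rw [← hyw] at hmax' ⊢
  have hfac : ∀ η : ℝ, (1 - η ^ 2 / h ^ 2) * ω ≤ ω := fun η => by
    have : 0 ≤ η ^ 2 / h ^ 2 * ω := by positivity
    linarith
  by_cases hfar : h ≤ y - a ∧ h ≤ b - y
  · have hl := hmax' (y - h) ⟨by linarith, by linarith [hy.2]⟩
    have hr := hmax' (y + h) ⟨by linarith [hy.1], by linarith⟩
    have hdh := hd y h hh.le le_rfl (by linarith) (by linarith)
    rw [div_self (by positivity), sub_self, zero_mul] at hdh
    have hle : y ≤ y - h := hleast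
      ⟨⟨by linarith, by linarith [hy.2]⟩, show w (y - h) = w m by rw [← hyw]; linarith⟩
    linarith
  · rcases le_total (y - a) (b - y) with hab | hab
    · have hη : y - a ≤ h := by
        by_contra hlt
        exact hfar ⟨by linarith, by linarith⟩
      have hdη := hd y (y - a) (by linarith [hy.1]) hη (by linarith) (by linarith)
      have hr := hmax' (y + (y - a)) ⟨by linarith [hy.1], by linarith⟩
      rw [sub_sub_cancel, ha] at hdη
      linarith [hfac (y - a)]
    · have hη : b - y ≤ h := by
        by_contra hlt
        exact hfar ⟨by linarith, by linarith⟩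
      have hdη := hd y (b - y) (by linarith [hy.2]) hη (by linarith) (by linarith)
      have hl := hmax' (y - (b - y)) ⟨by linarith, by linarith [hy.2]⟩
      rw [add_sub_cancel, hb] at hdη
      linarith [hfac (b - y)]

/-- The inequality for the two-point functional supported at `a`, `b` with barycenter `x`. -/
theorem chord_sub_le {F : ℝ → ℝ} {a b h ω x : ℝ} (hh : 0 < h) (hω : 0 ≤ ω)
    (hF : ContinuousOn F (Icc a b))
    (hd : ∀ y η, 0 ≤ η → η ≤ h → a ≤ y - η → y + η ≤ b →
      F (y - η) - 2 * F y + F (y + η) ≤ ω)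
    (hax : a < x) (hxb : x < b) :
    (F b - ω / (2 * h ^ 2) * (b - x) ^ 2 - (F x + ω)) / (b - x) ≤
      (F x + ω - (F a - ω / (2 * h ^ 2) * (a - x) ^ 2)) / (x - a) := by
  have hab : 0 < b - a := by linarith
  have key := le_of_secondDifference_le (x := x)
    (w := fun t => ((b - t) * F a + (t - a) * F b) / (b - a) - F t
      - ω / (2 * h ^ 2) * ((t - a) * (b - t))) hh hω
    (by fun_prop) (by field_simp; ring) (by field_simp; ring)
    (fun y η h0 h1 h2 h3 => by
      have := hd y η h0 h1 h2 h3
      have e : 2 * (((b - y) * F a + (y - a) * F b) / (b - a) - F y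
            - ω / (2 * h ^ 2) * ((y - a) * (b - y)))
          - (((b - (y - η)) * F a + (y - η - a) * F b) / (b - a) - F (y - η)
            - ω / (2 * h ^ 2) * ((y - η - a) * (b - (y - η))))
          - (((b - (y + η)) * F a + (y + η - a) * F b) / (b - a) - F (y + η)
            - ω / (2 * h ^ 2) * ((y + η - a) * (b - (y + η))))
          = F (y - η) - 2 * F y + F (y + η) - η ^ 2 / h ^ 2 * ω := by
        field_simp
        ring
      linarith)
    ⟨hax.le, hxb.le⟩
  have hmul := mul_le_mul_of_nonneg_left key hab.le
  have e : (b - a) * (((b - x) * F a + (x - a) * F b) / (b - a) - F x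
      - ω / (2 * h ^ 2) * ((x - a) * (b - x)))
      = (b - x) * F a + (x - a) * F b - (b - a) * F x
        - ω / (2 * h ^ 2) * ((x - a) * (b - x) * (b - a)) := by
    field_simp
  rw [div_le_div_iff₀ (by linarith) (by linarith)]
  simp only [e] at hmul
  linarith

theorem exists_sub_le_mul_abs {g : ℝ → ℝ} {x G : ℝ} (hg : ContinuousOn g I01) (hx : x ∈ I01)
    (hG : g x < G) : ∃ K, ∀ t ∈ I01, g t - G ≤ K * |t - x| := by
  obtain ⟨m, -, hmax⟩ := isCompact_Icc.exists_isMaxOn ⟨x, hx⟩ hg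
  obtain ⟨δ, hδ, hnear⟩ := Metric.continuousOn_iff.1 hg x hx (G - g x) (by linarith)
  refine ⟨|g m - G| / δ, fun t ht => ?_⟩
  rcases lt_or_ge |t - x| δ with hlt | hge
  · have := (abs_lt.1 (hnear t ht hlt)).2
    have : 0 ≤ |g m - G| / δ * |t - x| := by positivity
    linarith
  · calc g t - G ≤ g m - G := sub_le_sub_right (hmax ht) _
      _ ≤ |g m - G| := le_abs_self _
      _ = |g m - G| / δ * δ := by field_simp
      _ ≤ |g m - G| / δ * |t - x| := by gcongr

theorem exists_affine_majorant {g : ℝ → ℝ} {x G : ℝ} (hg : ContinuousOn g I01) (hx : x ∈ I01)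
    (hG : g x < G)
    (hchord : ∀ a ∈ I01, ∀ b ∈ I01, a < x → x < b →
      (g b - G) / (b - x) ≤ (G - g a) / (x - a)) :
    ∃ c, ∀ t ∈ I01, g t ≤ G + c * (t - x) := by
  obtain ⟨K, hK⟩ := exists_sub_le_mul_abs hg hx hG
  set S : Set ℝ := insert (-K) {s | ∃ b ∈ I01, x < b ∧ s = (g b - G) / (b - x)}
  have hbdd : BddAbove S := by
    refine BddAbove.insert _ ⟨K, ?_⟩
    rintro s ⟨b, hb, hxb, rfl⟩
    have := hK b hb
    rw [abs_of_pos (by linarith)] at this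
    rwa [div_le_iff₀ (by linarith)]
  refine ⟨sSup S, fun t ht => ?_⟩
  rcases lt_trichotomy t x with htx | rfl | hxt
  · have hle : sSup S ≤ (G - g t) / (x - t) := by
      refine csSup_le ⟨_, mem_insert _ _⟩ ?_
      rintro s (rfl | ⟨b, hb, hxb, rfl⟩)
      · have := hK t ht
        rw [abs_of_neg (by linarith)] at this
        rw [le_div_iff₀ (by linarith)]
        linarith
      · exact hchord t ht b hb htx hxb
    rw [le_div_iff₀ (by linarith)] at hle
    linarith
  · simpa using hG.le
  · have hle : (g t - G) / (t - x) ≤ sSup S :=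
      le_csSup hbdd (mem_insert_of_mem _ ⟨t, ht, hxt, rfl⟩)
    rw [div_le_iff₀ (by linarith)] at hle
    linarith

/-- For every `ε > 0`, `f` lies below a quadratic polynomial with leading coefficient
`omega2I f h / (2 * h ^ 2)` and value `f x + omega2I f h + ε` at its centre `x`. -/
theorem exists_quadratic_majorant (f : C(I01, ℝ)) (x : I01) {h ε : ℝ} (hh : 0 < h)
    (hε : 0 < ε) :
    ∃ c : ℝ, ∀ t : I01, f t ≤ f x + omega2I f h + ε + c * ((t : ℝ) - x)
      + omega2I f h / (2 * h ^ 2) * ((t : ℝ) - x) ^ 2 := by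
  have hω := omega2I_nonneg f h
  set F : ℝ → ℝ := IccExtend zero_le_one f
  have hFe : ∀ t (ht : t ∈ I01), F t = f ⟨t, ht⟩ := fun t ht => IccExtend_of_mem _ _ ht
  have hFc : Continuous F := f.continuous.Icc_extend'
  obtain ⟨c, hc⟩ := exists_affine_majorant
    (g := fun t => F t - omega2I f h / (2 * h ^ 2) * (t - x) ^ 2)
    (G := F x + omega2I f h + ε) (by fun_prop) x.2 (by simp; linarith)
    (fun a ha b hb hax hxb => by
      have hchord := chord_sub_le hh hω hFc.continuousOn (fun y η h0 h1 h2 h3 => by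
        have hy : y ∈ I01 := ⟨by linarith [ha.1], by linarith [hb.2]⟩
        have hl : y - η ∈ I01 := ⟨by linarith [ha.1], by linarith [hb.2]⟩
        have hr : y + η ∈ I01 := ⟨by linarith [ha.1], by linarith [hb.2]⟩
        rw [hFe _ hy, hFe _ hl, hFe _ hr]
        exact secondDifference_le_omega2I f (by rwa [abs_of_nonneg h0]) hy hl hr) hax hxb
      have hxa : 0 < (x : ℝ) - a := by linarith
      have hbx : 0 < b - (x : ℝ) := by linarith
      exact (div_le_div_of_nonneg_right (by linarith) hbx.le).trans
        (hchord.trans (div_le_div_of_nonneg_right (by linarith) hxa.le)))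
  refine ⟨c, fun t => ?_⟩
  have := hc t t.2
  rw [hFe t t.2, hFe x x.2] at this
  linarith

theorem apply_sub_le
    (L : C(I01, ℝ) →ₗ[ℝ] C(I01, ℝ))
    (hpos : ∀ f : C(I01, ℝ), (∀ x, 0 ≤ f x) → ∀ x, 0 ≤ L f x)
    (haff : ∀ a b : ℝ,
      L (ContinuousMap.mk (fun t : I01 => a * (t : ℝ) + b) (by fun_prop)) =
        ContinuousMap.mk (fun t : I01 => a * (t : ℝ) + b) (by fun_prop))
    (f : C(I01, ℝ)) (x : I01) (h : ℝ) (hh : 0 < h) :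
    L f x - f x ≤
      (1 + 1 / (2 * h ^ 2) *
        L (ContinuousMap.mk (fun t : I01 => ((t : ℝ) - (x : ℝ)) ^ 2) (by fun_prop)) x) *
        omega2I f h := by
  refine le_of_forall_pos_le_add fun ε hε => ?_
  obtain ⟨c, hc⟩ := exists_quadratic_majorant f x hh hε
  set q : C(I01, ℝ) := ContinuousMap.mk (fun t : I01 => ((t : ℝ) - (x : ℝ)) ^ 2) (by fun_prop)
  set b := f x + omega2I f h + ε - c * x with hb
  set p : C(I01, ℝ) := ContinuousMap.mk (fun t : I01 => c * (t : ℝ) + b) (by fun_prop) with hp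
  have hLp : L p x = c * x + b := by rw [hp, haff]; rfl
  have hL := hpos (p + (omega2I f h / (2 * h ^ 2)) • q - f) (fun t => by
    have hpt : p t = c * t + b := rfl
    have hqt : q t = ((t : ℝ) - x) ^ 2 := rfl
    simp only [ContinuousMap.sub_apply, ContinuousMap.add_apply, ContinuousMap.smul_apply,
      smul_eq_mul, hpt, hqt]
    linarith [hc t]) x
  simp only [map_sub, map_add, map_smul, ContinuousMap.sub_apply, ContinuousMap.add_apply,
    ContinuousMap.smul_apply, smul_eq_mul, hLp] at hL
  have e : (1 + 1 / (2 * h ^ 2) * L q x) * omega2I f h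
      = omega2I f h + omega2I f h / (2 * h ^ 2) * L q x := by ring
  linarith

theorem paltanea_inequality
    (L : C(I01, ℝ) →ₗ[ℝ] C(I01, ℝ))
    (hpos : ∀ f : C(I01, ℝ), (∀ x, 0 ≤ f x) → ∀ x, 0 ≤ L f x)
    (haff : ∀ a b : ℝ,
      L (ContinuousMap.mk (fun t : I01 => a * (t : ℝ) + b) (by fun_prop)) =
        ContinuousMap.mk (fun t : I01 => a * (t : ℝ) + b) (by fun_prop))
    (f : C(I01, ℝ)) (x : I01) (h : ℝ) (hh : 0 < h) :
    |L f x - f x| ≤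
      (1 + 1 / (2 * h ^ 2) *
        L (ContinuousMap.mk (fun t : I01 => ((t : ℝ) - (x : ℝ)) ^ 2) (by fun_prop)) x) *
        omega2I f h := by
  rw [abs_le']
  refine ⟨apply_sub_le L hpos haff f x h hh, ?_⟩
  have hneg := apply_sub_le L hpos haff (-f) x h hh
  rw [omega2I_neg, map_neg, ContinuousMap.neg_apply, ContinuousMap.neg_apply] at hneg
  linarith
end
end

section
/- If L : C[0,1] → C[0,1] is a positive linear operator which reproduces all affine (linear) functions, then for every f ∈ C[0,1] and every x ∈ [0,1], one has |L(f; x) - f(x)| ≤ (3/2)·ω₂(f; √(L((e₁ - x)²; x))), where e₁(t) = t; this holds also when L((e₁ - x)²; x) = 0. -/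
open Set Finset

noncomputable section

/-- If the second differences of `F` with step at most `h` are bounded above by `w` on `[y, z]`, then
the chord of `F` over `[y, z]` exceeds `F` at `x` by at most `(1 + (x - y) (z - x) / (2 h ^ 2)) w`. -/
theorem chord_le_of_second_difference_le {F : ℝ → ℝ} {y z h w : ℝ} (hyz : y < z)
    (hF : ContinuousOn F (Icc y z)) (hh : 0 < h)
    (hw : ∀ c d, 0 ≤ d → d ≤ h → c - d ∈ Icc y z → c + d ∈ Icc y z →
      F (c - d) - 2 * F c + F (c + d) ≤ w) {x : ℝ} (hx : x ∈ Icc y z) :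
    (z - x) * F y + (x - y) * F z ≤
      (z - y) * (F x + w + w / (2 * h ^ 2) * ((x - y) * (z - x))) := by
  have hzy : 0 < z - y := sub_pos.2 hyz
  have hw0 : 0 ≤ w := by
    have := hw y 0 le_rfl hh.le (by simp [hyz.le]) (by simp [hyz.le])
    simp only [sub_zero, add_zero] at this
    linarith
  set k := w / (2 * h ^ 2) with hk
  have hk0 : 0 ≤ k := by positivity
  have hkw : 2 * h ^ 2 * k = w := by rw [hk]; field_simp
  set g : ℝ → ℝ := fun t =>
    (z - y) * F t - ((z - t) * F y + (t - y) * F z) + (z - y) * (k * ((t - y) * (z - t))) with hg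
  have hgc : ContinuousOn g (Icc y z) := by fun_prop
  have hgd : ∀ c d, 0 ≤ d → d ≤ h → c - d ∈ Icc y z → c + d ∈ Icc y z →
      g (c - d) - 2 * g c + g (c + d) ≤ (z - y) * (w - 2 * k * d ^ 2) := by
    intro c d h0 h1 h2 h3
    have := mul_le_mul_of_nonneg_left (hw c d h0 h1 h2 h3) hzy.le
    simp only [hg]
    linarith
  have hgy : g y = 0 := by simp only [hg]; ring
  have hgz : g z = 0 := by simp only [hg]; ring
  obtain ⟨p, hp, hpmin⟩ := isCompact_Icc.exists_isMinOn (nonempty_Icc.2 hyz.le) hgc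
  have hSc : IsCompact (Icc y z ∩ g ⁻¹' {g p}) :=
    isCompact_Icc.of_isClosed_subset (hgc.preimage_isClosed_of_isClosed isClosed_Icc
      isClosed_singleton) inter_subset_left
  obtain ⟨m, ⟨hm, hmp⟩, hleast⟩ := hSc.exists_isLeast ⟨p, hp, rfl⟩
  have hmp : g m = g p := hmp
  have hmin : ∀ t ∈ Icc y z, g m ≤ g t := fun t ht => hmp ▸ hpmin ht
  suffices hmw : -((z - y) * w) ≤ g m by
    have := hmw.trans (hmin x hx)
    simp only [hg] at this
    linarith
  obtain ⟨hm1, hm2⟩ := hm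
  have hdrop : ∀ d : ℝ, 0 ≤ (z - y) * (2 * k * d ^ 2) := fun d => by positivity
  by_cases hfar : h ≤ m - y ∧ h ≤ z - m
  · have h1 : m - h ∈ Icc y z := ⟨by linarith, by linarith⟩
    have h2 : m + h ∈ Icc y z := ⟨by linarith, by linarith⟩
    have h3 := hgd m h hh.le le_rfl h1 h2
    rw [show w - 2 * k * h ^ 2 = 0 by linarith, mul_zero] at h3
    have h4 := hmin _ h1
    have h5 := hmin _ h2
    have h6 : g (m - h) = g p := by linarith
    have := hleast ⟨h1, h6⟩
    linarith
  · rcases le_total (m - y) (z - m) with hle | hle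
    · have hd : m - y ≤ h := by
        by_contra! hlt
        exact hfar ⟨hlt.le, hlt.le.trans hle⟩
      have h2 : m + (m - y) ∈ Icc y z := ⟨by linarith, by linarith⟩
      have h3 := hgd m (m - y) (by linarith) hd (by simp [hyz.le]) h2
      rw [sub_sub_cancel, hgy] at h3
      linarith [hmin _ h2, hdrop (m - y)]
    · have hd : z - m ≤ h := by
        by_contra! hlt
        exact hfar ⟨hlt.le.trans hle, hlt.le⟩
      have h2 : m - (z - m) ∈ Icc y z := ⟨by linarith, by linarith⟩
      have h3 := hgd m (z - m) (by linarith) hd h2 (by simp [hyz.le])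
      rw [add_sub_cancel, hgz] at h3
      linarith [hmin _ h2, hdrop (z - m)]

/-- A function all of whose chords pass below `(x, v)` lies below a line through `(x, v)`. -/
theorem exists_line_above_of_chord_le {G : ℝ → ℝ} {a b x v : ℝ} (hx : x ∈ Ioo a b) (hGx : G x ≤ v)
    (hG : ∀ y z, a ≤ y → y < x → x < z → z ≤ b → (z - x) * G y + (x - y) * G z ≤ (z - y) * v) :
    ∃ s, ∀ t ∈ Icc a b, G t ≤ v + s * (t - x) := by
  have hslope : ∀ y z, a ≤ y → y < x → x < z → z ≤ b →
      (G z - v) / (z - x) ≤ (v - G y) / (x - y) := by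
    intro y z hy hyx hxz hz
    rw [div_le_div_iff₀ (by linarith) (by linarith)]
    linarith [hG y z hy hyx hxz hz]
  set S := (fun z => (G z - v) / (z - x)) '' Ioc x b
  have hub : ∀ y, a ≤ y → y < x → (v - G y) / (x - y) ∈ upperBounds S := by
    rintro y hy hyx _ ⟨z, hz, rfl⟩
    exact hslope y z hy hyx hz.1 hz.2
  refine ⟨sSup S, fun t ht => ?_⟩
  rcases lt_trichotomy t x with htx | rfl | htx
  · have h1 : sSup S ≤ (v - G t) / (x - t) :=
      csSup_le ((Set.nonempty_Ioc.2 hx.2).image _) (hub t ht.1 htx)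
    rw [le_div_iff₀ (by linarith)] at h1
    linarith
  · simpa using hGx
  · have h1 : (G t - v) / (t - x) ≤ sSup S :=
      le_csSup ⟨_, hub a le_rfl hx.1⟩ ⟨t, ⟨htx, ht.2⟩, rfl⟩
    rw [div_le_iff₀ (by linarith)] at h1
    linarith

theorem abs_second_difference_le_omega2I (f : C(I01, ℝ)) {δ c d : ℝ} (hc : c ∈ I01)
    (h1 : c - d ∈ I01) (h2 : c + d ∈ I01) (hd : |d| ≤ δ) :
    |f ⟨c - d, h1⟩ - 2 * f ⟨c, hc⟩ + f ⟨c + d, h2⟩| ≤ omega2I f δ := by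
  refine le_csSup ⟨4 * ‖f‖, ?_⟩ ⟨c, d, hc, h1, h2, hd, rfl⟩
  rintro _ ⟨x, h, hx, h1, h2, -, rfl⟩
  have e1 := abs_le.1 (f.norm_coe_le_norm ⟨x - h, h1⟩)
  have e2 := abs_le.1 (f.norm_coe_le_norm ⟨x, hx⟩)
  have e3 := abs_le.1 (f.norm_coe_le_norm ⟨x + h, h2⟩)
  exact abs_le.2 ⟨by linarith, by linarith⟩

/-- Near an interior point, `f` lies below a parabola governed by its second modulus. -/
theorem exists_le_parabola_omega2I (f : C(I01, ℝ)) (x : I01) (hx : (x : ℝ) ∈ Ioo (0 : ℝ) 1)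
    {h : ℝ} (hh : 0 < h) :
    ∃ s, ∀ t : I01, f t ≤ f x + s * ((t : ℝ) - x) + omega2I f h
      + omega2I f h / (2 * h ^ 2) * ((t : ℝ) - x) ^ 2 := by
  set w := omega2I f h
  set F : ℝ → ℝ := IccExtend zero_le_one f
  have hFc : Continuous F := f.continuous.Icc_extend'
  have hFf : ∀ t (ht : t ∈ I01), F t = f ⟨t, ht⟩ := fun t ht => IccExtend_of_mem _ _ ht
  have hFw : ∀ c d, 0 ≤ d → d ≤ h → c - d ∈ I01 → c + d ∈ I01 →
      F (c - d) - 2 * F c + F (c + d) ≤ w := by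
    intro c d h0 h1 h2 h3
    have hc : c ∈ I01 := ⟨by linarith [h2.1], by linarith [h3.2]⟩
    rw [hFf _ h2, hFf _ h3, hFf _ hc]
    exact (le_abs_self _).trans
      (abs_second_difference_le_omega2I f hc h2 h3 (by rwa [abs_of_nonneg h0]))
  obtain ⟨s, hs⟩ := exists_line_above_of_chord_le
    (x := (x : ℝ)) (G := fun t => F t - w - w / (2 * h ^ 2) * (t - x) ^ 2) (v := f x) hx
    (by simpa [hFf _ x.2] using omega2I_nonneg f h) (by
      intro y z hy hyx hxz hz
      have hsub : Icc y z ⊆ I01 := Icc_subset_Icc hy hz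
      have := chord_le_of_second_difference_le (hyx.trans hxz) hFc.continuousOn hh
        (fun c d h0 h1 h2 h3 => hFw c d h0 h1 (hsub h2) (hsub h3)) ⟨hyx.le, hxz.le⟩
      rw [hFf _ x.2] at this
      linarith)
  refine ⟨s, fun t => ?_⟩
  have := hs t t.2
  simp only [hFf _ t.2, Subtype.coe_eta] at this
  linarith

/-- By continuity, `f` lies below arbitrarily low parabolas centred at `x`. -/
theorem exists_le_add_mul_sq (f : C(I01, ℝ)) (x : I01) {ε : ℝ} (hε : 0 < ε) :
    ∃ C : ℝ, ∀ t : I01, f t ≤ f x + ε + C * ((t : ℝ) - x) ^ 2 := by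
  obtain ⟨δ, hδ, hfδ⟩ := Metric.continuous_iff.1 f.continuous x ε hε
  refine ⟨2 * ‖f‖ / δ ^ 2, fun t => ?_⟩
  rcases lt_or_ge (dist t x) δ with htx | htx
  · have h1 := (abs_lt.1 (hfδ t htx)).2
    have : 0 ≤ 2 * ‖f‖ / δ ^ 2 * ((t : ℝ) - x) ^ 2 := by positivity
    linarith
  · have h1 := (abs_le.1 (f.norm_coe_le_norm t)).2
    have h2 := (abs_le.1 (f.norm_coe_le_norm x)).1
    have h3 : δ ^ 2 ≤ ((t : ℝ) - x) ^ 2 := by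
      rw [← sq_abs ((t : ℝ) - x)]
      exact pow_le_pow_left₀ hδ.le htx 2
    have h4 : 2 * ‖f‖ ≤ 2 * ‖f‖ / δ ^ 2 * ((t : ℝ) - x) ^ 2 := by
      rw [div_mul_eq_mul_div, le_div_iff₀ (by positivity)]
      gcongr
    linarith

/-- A positive operator reproducing affine functions respects bounds by parabolas. -/
theorem map_le_of_le_parabola
    {L : C(I01, ℝ) →ₗ[ℝ] C(I01, ℝ)}
    (hpos : ∀ f : C(I01, ℝ), (∀ x, 0 ≤ f x) → ∀ x, 0 ≤ L f x)
    (haff : ∀ a b : ℝ,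
      L (ContinuousMap.mk (fun t : I01 => a * (t : ℝ) + b) (by fun_prop)) =
        ContinuousMap.mk (fun t : I01 => a * (t : ℝ) + b) (by fun_prop))
    {f : C(I01, ℝ)} {x : I01} {a b c : ℝ}
    (hf : ∀ t : I01, f t ≤ a * (t : ℝ) + b + c * ((t : ℝ) - x) ^ 2) :
    L f x ≤ a * (x : ℝ) + b + c *
      L (ContinuousMap.mk (fun t : I01 => ((t : ℝ) - (x : ℝ)) ^ 2) (by fun_prop)) x := by
  have h := hpos (ContinuousMap.mk (fun t : I01 => a * (t : ℝ) + b) (by fun_prop)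
    + c • ContinuousMap.mk (fun t : I01 => ((t : ℝ) - (x : ℝ)) ^ 2) (by fun_prop) - f)
    (fun t => by simpa using hf t) x
  rw [map_sub, map_add, map_smul, haff] at h
  simpa using h

/-- One-sided form of the inequality. -/
theorem map_sub_le_omega2I
    {L : C(I01, ℝ) →ₗ[ℝ] C(I01, ℝ)}
    (hpos : ∀ f : C(I01, ℝ), (∀ x, 0 ≤ f x) → ∀ x, 0 ≤ L f x)
    (haff : ∀ a b : ℝ,
      L (ContinuousMap.mk (fun t : I01 => a * (t : ℝ) + b) (by fun_prop)) =
        ContinuousMap.mk (fun t : I01 => a * (t : ℝ) + b) (by fun_prop))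
    (f : C(I01, ℝ)) (x : I01) :
    L f x - f x ≤
      3 / 2 * omega2I f (Real.sqrt
        (L (ContinuousMap.mk (fun t : I01 => ((t : ℝ) - (x : ℝ)) ^ 2) (by fun_prop)) x)) := by
  set V := L (ContinuousMap.mk (fun t : I01 => ((t : ℝ) - (x : ℝ)) ^ 2) (by fun_prop)) x with hV
  have hV0 : 0 ≤ V := hpos _ (fun t => sq_nonneg _) x
  rcases hV0.eq_or_lt with hV0 | hV0
  · have hle : L f x ≤ f x := by
      refine le_of_forall_pos_le_add fun ε hε => ?_
      obtain ⟨C, hC⟩ := exists_le_add_mul_sq f x hε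
      have := map_le_of_le_parabola hpos haff (a := 0) (b := f x + ε) (c := C)
        (fun t => by linarith [hC t])
      rw [← hV, ← hV0] at this
      linarith
    linarith [omega2I_nonneg f (Real.sqrt V)]
  · have hVx : V ≤ x * (1 - x) := by
      have := map_le_of_le_parabola hpos haff (x := x) (a := 1 - 2 * (x : ℝ)) (b := (x : ℝ) ^ 2)
        (c := 0) (f := ContinuousMap.mk (fun t : I01 => ((t : ℝ) - (x : ℝ)) ^ 2) (by fun_prop))
        (fun t => by
          have := mul_nonneg t.2.1 (sub_nonneg.2 t.2.2)
          simp only [ContinuousMap.coe_mk]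
          linarith)
      rw [← hV] at this
      linarith
    have hx : (x : ℝ) ∈ Ioo (0 : ℝ) 1 := by
      have := hV0.trans_le hVx
      exact ⟨pos_of_mul_pos_left this (sub_nonneg.2 x.2.2),
        sub_pos.1 (pos_of_mul_pos_right this x.2.1)⟩
    obtain ⟨s, hs⟩ := exists_le_parabola_omega2I f x hx (Real.sqrt_pos.2 hV0)
    rw [Real.sq_sqrt hV0.le] at hs
    set w := omega2I f (Real.sqrt V)
    have := map_le_of_le_parabola hpos haff (a := s) (b := f x - s * x + w) (c := w / (2 * V))
      (fun t => (hs t).trans_eq (by ring))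
    rw [← hV, show w / (2 * V) * V = w / 2 by field_simp] at this
    linarith

theorem paltanea_inequality_sqrt
    (L : C(I01, ℝ) →ₗ[ℝ] C(I01, ℝ))
    (hpos : ∀ f : C(I01, ℝ), (∀ x, 0 ≤ f x) → ∀ x, 0 ≤ L f x)
    (haff : ∀ a b : ℝ,
      L (ContinuousMap.mk (fun t : I01 => a * (t : ℝ) + b) (by fun_prop)) =
        ContinuousMap.mk (fun t : I01 => a * (t : ℝ) + b) (by fun_prop))
    (f : C(I01, ℝ)) (x : I01) :
    |L f x - f x| ≤
      3 / 2 * omega2I f (Real.sqrt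
        (L (ContinuousMap.mk (fun t : I01 => ((t : ℝ) - (x : ℝ)) ^ 2) (by fun_prop)) x)) := by
  refine abs_sub_le_iff.2 ⟨map_sub_le_omega2I hpos haff f x, ?_⟩
  have := map_sub_le_omega2I hpos haff (-f) x
  rw [omega2I_neg, map_neg, ContinuousMap.neg_apply, ContinuousMap.neg_apply] at this
  linarith
end
end

section
/- Let n, m be positive integers and 1 ≤ k ≤ m. For every f ∈ C[0,1] and every x ∈ [(k-1)/m, k/m], one has |B̄_{n,m}(f; x) - f(x)| ≤ (3/2)·ω₂(f; √((x - (k-1)/m)·(k/m - x)/n)). -/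
open Set Finset

noncomputable section

/-- Second order modulus of smoothness of `f` on `[a,b]`. -/
def omega2 (a b : ℝ) (f : ℝ → ℝ) (δ : ℝ) : ℝ :=
  sSup {v | ∃ x h : ℝ, x - h ∈ Set.Icc a b ∧ x + h ∈ Set.Icc a b ∧ |h| ≤ δ ∧
    v = |f (x - h) - 2 * f x + f (x + h)|}

/-- A maximum principle for functions whose symmetric second differences of step at most `δ`
are bounded below by `W * (s ^ 2 / δ ^ 2 - 1)`. -/
theorem le_of_second_difference_ge {u v δ W : ℝ} {G : ℝ → ℝ} (hδ : 0 < δ) (hW : 0 ≤ W)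
    (huv : u ≤ v) (hG : ContinuousOn G (Set.Icc u v)) (hu : G u ≤ 0) (hv : G v ≤ 0)
    (hΔ : ∀ y s, y - s ∈ Set.Icc u v → y + s ∈ Set.Icc u v → |s| ≤ δ →
      W * (s ^ 2 / δ ^ 2 - 1) ≤ G (y - s) - 2 * G y + G (y + s))
    {x : ℝ} (hx : x ∈ Set.Icc u v) : G x ≤ W := by
  obtain ⟨z, hz, hzmax⟩ := isCompact_Icc.exists_isMaxOn (Set.nonempty_Icc.2 huv) hG
  have hmax : ∀ t ∈ Set.Icc u v, G t ≤ G z := fun t ht => hzmax ht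
  have hK : IsCompact (Set.Icc u v ∩ G ⁻¹' {G z}) :=
    isCompact_Icc.of_isClosed_subset
      (hG.preimage_isClosed_of_isClosed isClosed_Icc isClosed_singleton) Set.inter_subset_left
  obtain ⟨y, ⟨hy, hyz⟩, hleast⟩ := hK.exists_isLeast ⟨z, hz, rfl⟩
  have hyz' : G y = G z := hyz
  refine (hmax x hx).trans ?_
  have hsq : ∀ s, 0 ≤ W * (s ^ 2 / δ ^ 2) := fun s => by positivity
  obtain ⟨hy1, hy2⟩ := hy
  by_cases h1 : y - u ≤ δ ∧ y - u ≤ v - y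
  · have hr : y + (y - u) ∈ Set.Icc u v := ⟨by linarith, by linarith [h1.2]⟩
    have hl : y - (y - u) = u := by ring
    have h := hΔ y (y - u) (by rw [hl]; exact ⟨le_rfl, huv⟩) hr
      (by rw [abs_of_nonneg (by linarith)]; exact h1.1)
    rw [hl] at h
    linarith [hmax _ hr, hsq (y - u)]
  by_cases h2 : v - y ≤ δ ∧ v - y ≤ y - u
  · have hl : y - (v - y) ∈ Set.Icc u v := ⟨by linarith [h2.2], by linarith⟩
    have hr : y + (v - y) = v := by ring
    have h := hΔ y (v - y) hl (by rw [hr]; exact ⟨huv, le_rfl⟩)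
      (by rw [abs_of_nonneg (by linarith)]; exact h2.1)
    rw [hr] at h
    linarith [hmax _ hl, hsq (v - y)]
  have h3 : δ < y - u ∧ δ < v - y := by
    by_contra hcon
    grind
  have hl : y - δ ∈ Set.Icc u v := ⟨by linarith [h3.1], by linarith⟩
  have hr : y + δ ∈ Set.Icc u v := ⟨by linarith, by linarith [h3.2]⟩
  have h := hΔ y δ hl hr (abs_of_pos hδ).le
  rw [div_self (by positivity), sub_self, mul_zero] at h
  have hmem : G (y - δ) = G z := le_antisymm (hmax _ hl) (by linarith [hmax _ hr])
  have := hleast ⟨hl, hmem⟩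
  linarith

/-- The deviation of `f` above its chord over `[u, v]`, in terms of lower bounds for the
symmetric second differences of `f` of step at most `δ`. -/
theorem sub_chord_le {u v δ W : ℝ} {f : ℝ → ℝ} (hδ : 0 < δ) (hW : 0 ≤ W)
    (huv : u < v) (hf : ContinuousOn f (Set.Icc u v))
    (hΔ : ∀ y s, y - s ∈ Set.Icc u v → y + s ∈ Set.Icc u v → |s| ≤ δ →
      -W ≤ f (y - s) - 2 * f y + f (y + s))
    {x : ℝ} (hx : x ∈ Set.Icc u v) :
    f x - ((v - x) * f u + (x - u) * f v) / (v - u) ≤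
      W * (1 + (x - u) * (v - x) / (2 * δ ^ 2)) := by
  have hd : v - u ≠ 0 := by linarith
  have key := le_of_second_difference_ge (x := x) (u := u) (v := v) (δ := δ) (W := W)
    (G := fun y => f y - ((v - y) * f u + (y - u) * f v) / (v - u)
      - W * ((y - u) * (v - y) / (2 * δ ^ 2))) hδ hW huv.le
    ((hf.sub (by fun_prop)).sub (by fun_prop))
    (by apply le_of_eq; field_simp; ring) (by apply le_of_eq; field_simp; ring) ?_ hx
  · linarith
  · intro y s h1 h2 h3
    have h := hΔ y s h1 h2 h3
    have e : (f (y - s) - ((v - (y - s)) * f u + ((y - s) - u) * f v) / (v - u)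
        - W * (((y - s) - u) * (v - (y - s)) / (2 * δ ^ 2)))
        - 2 * (f y - ((v - y) * f u + (y - u) * f v) / (v - u)
        - W * ((y - u) * (v - y) / (2 * δ ^ 2)))
        + (f (y + s) - ((v - (y + s)) * f u + ((y + s) - u) * f v) / (v - u)
        - W * (((y + s) - u) * (v - (y + s)) / (2 * δ ^ 2)))
        = f (y - s) - 2 * f y + f (y + s) + W * (s ^ 2 / δ ^ 2) := by
      field_simp
      ring
    rw [e]
    linarith

/-- A function whose two-point averages with barycenter `x` are nonnegative is bounded below by
a linear function vanishing at `x`. -/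
theorem exists_linear_le {a b x : ℝ} {φ : ℝ → ℝ} (hax : a < x) (hxb : x < b) (hφx : 0 ≤ φ x)
    (hφ : ∀ u ∈ Set.Ico a x, ∀ v ∈ Set.Ioc x b, 0 ≤ (v - x) * φ u + (x - u) * φ v) :
    ∃ c : ℝ, ∀ t ∈ Set.Icc a b, c * (t - x) ≤ φ t := by
  have hle : ∀ u ∈ Set.Ico a x, ∀ v ∈ Set.Ioc x b, -φ u / (x - u) ≤ φ v / (v - x) := by
    intro u hu v hv
    rw [div_le_div_iff₀ (by linarith [hu.2]) (by linarith [hv.1])]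
    linarith [hφ u hu v hv]
  set S := (fun u => -φ u / (x - u)) '' Set.Ico a x with hS
  have hbdd : ∀ v ∈ Set.Ioc x b, φ v / (v - x) ∈ upperBounds S := by
    rintro v hv _ ⟨u, hu, rfl⟩
    exact hle u hu v hv
  refine ⟨sSup S, fun t ht => ?_⟩
  rcases lt_trichotomy t x with h | rfl | h
  · have h1 : -φ t / (x - t) ≤ sSup S :=
      le_csSup ⟨_, hbdd b ⟨hxb, le_rfl⟩⟩ ⟨t, ⟨ht.1, h⟩, rfl⟩
    rw [div_le_iff₀ (by linarith)] at h1
    linarith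
  · simpa using hφx
  · have h1 : sSup S ≤ φ t / (t - x) :=
      csSup_le ⟨_, a, ⟨le_rfl, hax⟩, rfl⟩ (hbdd t ⟨h, ht.2⟩)
    rwa [le_div_iff₀ (by linarith)] at h1

/-- One-sided Păltănea estimate for a finitely supported probability measure with mean `x` and
variance `δ ^ 2`. -/
theorem sub_sum_le {ι : Type*} {s : Finset ι} {w t : ι → ℝ} {a b x δ W : ℝ} {f : ℝ → ℝ}
    (hw : ∀ i ∈ s, 0 ≤ w i) (ht : ∀ i ∈ s, t i ∈ Set.Icc a b) (hw1 : ∑ i ∈ s, w i = 1)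
    (hmean : ∑ i ∈ s, w i * (t i - x) = 0) (hvar : ∑ i ∈ s, w i * (t i - x) ^ 2 = δ ^ 2)
    (hδ : 0 < δ) (hW : 0 ≤ W) (hax : a < x) (hxb : x < b) (hf : ContinuousOn f (Set.Icc a b))
    (hΔ : ∀ y s, y - s ∈ Set.Icc a b → y + s ∈ Set.Icc a b → |s| ≤ δ →
      -W ≤ f (y - s) - 2 * f y + f (y + s)) :
    f x - ∑ i ∈ s, w i * f (t i) ≤ 3 / 2 * W := by
  obtain ⟨c, hc⟩ := exists_linear_le (a := a) (b := b) (x := x)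
    (φ := fun t => f t - f x + W + W / (2 * δ ^ 2) * (t - x) ^ 2) hax hxb (by simpa using hW) (by
      intro u hu v hv
      have hux := hu.2
      have hxv := hv.1
      have hsub : Set.Icc u v ⊆ Set.Icc a b := Set.Icc_subset_Icc hu.1 hv.2
      have h := sub_chord_le hδ hW (hux.trans hxv) (hf.mono hsub)
        (fun y s h1 h2 h3 => hΔ y s (hsub h1) (hsub h2) h3) ⟨hux.le, hxv.le⟩
      have hd : 0 < v - u := by linarith
      have h' := mul_le_mul_of_nonneg_left h hd.le
      rw [mul_sub, mul_div_cancel₀ _ hd.ne'] at h'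
      have e : (v - u) * (W * (1 + (x - u) * (v - x) / (2 * δ ^ 2)))
          = (v - u) * W + W / (2 * δ ^ 2) * ((v - x) * (u - x) ^ 2 + (x - u) * (v - x) ^ 2) := by
        field_simp
        ring
      rw [e] at h'
      linarith)
  have h := Finset.sum_le_sum fun i hi => mul_le_mul_of_nonneg_left (hc _ (ht i hi)) (hw i hi)
  have e1 : ∑ i ∈ s, w i * (c * (t i - x)) = 0 := by
    rw [← mul_zero c, ← hmean, Finset.mul_sum]
    exact Finset.sum_congr rfl fun i _ => by ring
  have e2 : ∑ i ∈ s, w i * (f (t i) - f x + W + W / (2 * δ ^ 2) * (t i - x) ^ 2)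
      = ∑ i ∈ s, w i * f (t i) - f x + W + W / 2 := by
    have : ∀ i ∈ s, w i * (f (t i) - f x + W + W / (2 * δ ^ 2) * (t i - x) ^ 2)
        = w i * f (t i) + w i * (W - f x) + W / (2 * δ ^ 2) * (w i * (t i - x) ^ 2) :=
      fun i _ => by ring
    rw [Finset.sum_congr rfl this, Finset.sum_add_distrib, Finset.sum_add_distrib,
      ← Finset.sum_mul, ← Finset.mul_sum, hw1, hvar]
    field_simp
    ring
  rw [e1, e2] at h
  linarith

/-- Păltănea's estimate for a finitely supported probability measure on `[a, b]` with mean `x`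
and variance `δ ^ 2`. -/
theorem abs_sum_sub_le {ι : Type*} {s : Finset ι} {w t : ι → ℝ} {a b x δ W : ℝ} {f : ℝ → ℝ}
    (hw : ∀ i ∈ s, 0 ≤ w i) (ht : ∀ i ∈ s, t i ∈ Set.Icc a b) (hw1 : ∑ i ∈ s, w i = 1)
    (hmean : ∑ i ∈ s, w i * (t i - x) = 0) (hvar : ∑ i ∈ s, w i * (t i - x) ^ 2 = δ ^ 2)
    (hδ : 0 < δ) (hW : 0 ≤ W) (hax : a < x) (hxb : x < b) (hf : ContinuousOn f (Set.Icc a b))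
    (hΔ : ∀ y s, y - s ∈ Set.Icc a b → y + s ∈ Set.Icc a b → |s| ≤ δ →
      |f (y - s) - 2 * f y + f (y + s)| ≤ W) :
    |∑ i ∈ s, w i * f (t i) - f x| ≤ 3 / 2 * W := by
  have h1 := sub_sum_le hw ht hw1 hmean hvar hδ hW hax hxb hf
    fun y s h1 h2 h3 => (abs_le.1 (hΔ y s h1 h2 h3)).1
  have h2 := sub_sum_le (f := fun y => -f y) hw ht hw1 hmean hvar hδ hW hax hxb hf.neg
    fun y s h1 h2 h3 => by linarith [(abs_le.1 (hΔ y s h1 h2 h3)).2]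
  simp only [mul_neg, Finset.sum_neg_distrib] at h2
  exact abs_le.2 ⟨by linarith, by linarith⟩

theorem abs_second_difference_le_omega2 {a b δ : ℝ} {f : ℝ → ℝ}
    (hf : ContinuousOn f (Set.Icc a b)) {y s : ℝ} (h1 : y - s ∈ Set.Icc a b)
    (h2 : y + s ∈ Set.Icc a b) (h3 : |s| ≤ δ) :
    |f (y - s) - 2 * f y + f (y + s)| ≤ omega2 a b f δ := by
  obtain ⟨C, hC⟩ := isCompact_Icc.exists_bound_of_continuousOn hf
  refine le_csSup ⟨4 * C, ?_⟩ ⟨y, s, h1, h2, h3, rfl⟩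
  rintro _ ⟨z, r, hz1, hz2, -, rfl⟩
  have hz : z ∈ Set.Icc a b :=
    ⟨by linarith [hz1.1, hz2.1], by linarith [hz1.2, hz2.2]⟩
  have A := abs_le.1 (hC _ hz1)
  have B := abs_le.1 (hC _ hz2)
  have D := abs_le.1 (hC _ hz)
  exact abs_le.2 ⟨by linarith, by linarith⟩

theorem omega2_nonneg (a b : ℝ) (f : ℝ → ℝ) (δ : ℝ) : 0 ≤ omega2 a b f δ :=
  Real.sSup_nonneg (by rintro _ ⟨z, r, -, -, -, rfl⟩; exact abs_nonneg _)

/-- The moments of order at most two of the Bernstein weights. -/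
theorem bernstein_weight_moments {n : ℕ} (hn : 0 < n) (y : ℝ) :
    ∑ i ∈ Finset.range (n + 1), (n.choose i : ℝ) * y ^ i * (1 - y) ^ (n - i) = 1 ∧
    ∑ i ∈ Finset.range (n + 1), (n.choose i : ℝ) * y ^ i * (1 - y) ^ (n - i) * (i / n - y) = 0 ∧
    ∑ i ∈ Finset.range (n + 1), (n.choose i : ℝ) * y ^ i * (1 - y) ^ (n - i) * (i / n - y) ^ 2
      = y * (1 - y) / n := by
  have hn' : (n : ℝ) ≠ 0 := by positivity
  have h0 := congrArg (Polynomial.eval y) (bernsteinPolynomial.sum ℝ n)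
  have h1 := congrArg (Polynomial.eval y) (bernsteinPolynomial.sum_smul ℝ n)
  have h2 := congrArg (Polynomial.eval y) (bernsteinPolynomial.variance ℝ n)
  simp [Polynomial.eval_finsetSum, bernsteinPolynomial] at h0 h1 h2
  refine ⟨h0, ?_, ?_⟩
  · have : ∀ i ∈ Finset.range (n + 1),
        (n.choose i : ℝ) * y ^ i * (1 - y) ^ (n - i) * (i / n - y) =
        1 / n * (i * ((n.choose i : ℝ) * y ^ i * (1 - y) ^ (n - i))) -
          y * ((n.choose i : ℝ) * y ^ i * (1 - y) ^ (n - i)) := fun i _ => by ring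
    rw [Finset.sum_congr rfl this, Finset.sum_sub_distrib, ← Finset.mul_sum, ← Finset.mul_sum,
      h0, h1]
    field_simp
    ring
  · have : ∀ i ∈ Finset.range (n + 1),
        (n.choose i : ℝ) * y ^ i * (1 - y) ^ (n - i) * (i / n - y) ^ 2 =
        1 / n ^ 2 * ((n * y - i) ^ 2 * ((n.choose i : ℝ) * y ^ i * (1 - y) ^ (n - i))) :=
      fun i _ => by field_simp; ring
    rw [Finset.sum_congr rfl this, ← Finset.mul_sum, h2]
    field_simp

theorem bernsteinPiece_eq {n m : ℕ} (hn : 0 < n) (hm : 0 < m) (k : ℕ) (f : ℝ → ℝ) (x : ℝ) :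
    bernsteinPiece n m k f x = ∑ i ∈ Finset.range (n + 1),
      (n.choose i : ℝ) * (m * x - (k - 1)) ^ i * (1 - (m * x - (k - 1))) ^ (n - i) *
        f ((k - 1) / m + i / n / m) := by
  have hn' : (n : ℝ) ≠ 0 := by positivity
  have hm' : (m : ℝ) ≠ 0 := by positivity
  rw [bernsteinPiece, Finset.mul_sum]
  refine Finset.sum_congr rfl fun i hi => ?_
  have hi' : i ≤ n := Nat.lt_succ_iff.1 (Finset.mem_range.1 hi)
  have e1 : (m : ℝ) * x - (k - 1) = m * (x - ((k : ℝ) - 1) / m) := by field_simp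
  have e2 : 1 - ((m : ℝ) * x - (k - 1)) = m * ((k : ℝ) / m - x) := by
    rw [mul_sub, mul_div_cancel₀ _ hm']
    ring
  have e3 : ((k : ℝ) * n - n + i) / (m * n) = (k - 1) / m + i / n / m := by field_simp
  have e4 : (m : ℝ) ^ n = m ^ i * m ^ (n - i) := by rw [← pow_add, Nat.add_sub_cancel' hi']
  rw [e2, e1, e3, e4, mul_pow, mul_pow]
  ring

theorem abs_bernsteinPiece_sub_le {n m : ℕ} (hn : 0 < n) (hm : 0 < m) {k : ℕ} (hk1 : 1 ≤ k)
    (hk2 : k ≤ m) {f : ℝ → ℝ} (hf : ContinuousOn f (Set.Icc 0 1)) {x : ℝ}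
    (hx : x ∈ Set.Icc (((k : ℝ) - 1) / (m : ℝ)) ((k : ℝ) / (m : ℝ))) :
    |bernsteinPiece n m k f x - f x| ≤
      3 / 2 * omega2 0 1 f
        (Real.sqrt ((x - ((k : ℝ) - 1) / (m : ℝ)) * ((k : ℝ) / (m : ℝ) - x) / (n : ℝ))) := by
  have hn0 : (0 : ℝ) < n := by positivity
  have hm0 : (0 : ℝ) < m := by positivity
  have hk1' : (1 : ℝ) ≤ k := by exact_mod_cast hk1
  have hk2' : (k : ℝ) ≤ m := by exact_mod_cast hk2
  obtain ⟨hx1, hx2⟩ := hx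
  have hy0 : 0 ≤ (m : ℝ) * x - (k - 1) := by
    rw [div_le_iff₀ hm0] at hx1
    linarith
  have hy1 : 0 ≤ 1 - ((m : ℝ) * x - (k - 1)) := by
    rw [le_div_iff₀ hm0] at hx2
    linarith
  rw [bernsteinPiece_eq hn hm]
  set y := (m : ℝ) * x - (k - 1) with hy
  have hxy : x = (k - 1) / m + y / m := by rw [hy]; field_simp; ring
  have hprod : (x - ((k : ℝ) - 1) / m) * ((k : ℝ) / m - x) / n = y * (1 - y) / n / m ^ 2 := by
    rw [hy]
    field_simp
    ring
  have hsub : ∀ i : ℕ, ((k : ℝ) - 1) / m + i / n / m - x = (i / n - y) / m := fun i => by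
    rw [hxy]
    ring
  obtain ⟨M0, M1, M2⟩ := bernstein_weight_moments hn y
  set δ := Real.sqrt ((x - ((k : ℝ) - 1) / m) * ((k : ℝ) / m - x) / n) with hδ
  have hδsq : δ ^ 2 = y * (1 - y) / n / m ^ 2 := by
    rw [hδ, Real.sq_sqrt (by rw [hprod]; positivity), hprod]
  have hw : ∀ i ∈ Finset.range (n + 1), 0 ≤ (n.choose i : ℝ) * y ^ i * (1 - y) ^ (n - i) :=
    fun i _ => by positivity
  have hmean : ∑ i ∈ Finset.range (n + 1), (n.choose i : ℝ) * y ^ i * (1 - y) ^ (n - i) *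
      (((k : ℝ) - 1) / m + i / n / m - x) = 0 := by
    simp_rw [hsub, ← mul_div_assoc]
    rw [← Finset.sum_div, M1, zero_div]
  have hvar : ∑ i ∈ Finset.range (n + 1), (n.choose i : ℝ) * y ^ i * (1 - y) ^ (n - i) *
      (((k : ℝ) - 1) / m + i / n / m - x) ^ 2 = δ ^ 2 := by
    simp_rw [hsub, div_pow, ← mul_div_assoc]
    rw [← Finset.sum_div, M2, hδsq]
  have hδ0 : 0 ≤ δ := Real.sqrt_nonneg _
  rcases hδ0.eq_or_lt with h0 | hpos
  · rw [← h0, zero_pow two_ne_zero,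
      Finset.sum_eq_zero_iff_of_nonneg fun i hi => mul_nonneg (hw i hi) (sq_nonneg _)] at hvar
    have hfx : ∀ i ∈ Finset.range (n + 1), (n.choose i : ℝ) * y ^ i * (1 - y) ^ (n - i) *
        f (((k : ℝ) - 1) / m + i / n / m) =
        (n.choose i : ℝ) * y ^ i * (1 - y) ^ (n - i) * f x := fun i hi => by
      rcases mul_eq_zero.1 (hvar i hi) with h | h
      · rw [h, zero_mul, zero_mul]
      · rw [sub_eq_zero.1 (pow_eq_zero_iff two_ne_zero |>.1 h)]
    rw [Finset.sum_congr rfl hfx, ← Finset.sum_mul, M0, one_mul, sub_self, abs_zero]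
    exact mul_nonneg (by norm_num) (omega2_nonneg _ _ _ _)
  · have hyy : 0 < y * (1 - y) := by
      by_contra hcon
      have : δ ^ 2 ≤ 0 := by
        rw [hδsq, le_antisymm (not_lt.1 hcon) (mul_nonneg hy0 hy1)]
        simp
      have := pow_pos hpos 2
      linarith
    have hy0' : 0 < y := by nlinarith
    have hy1' : 0 < 1 - y := by nlinarith
    refine abs_sum_sub_le hw ?_ M0 hmean hvar hpos (omega2_nonneg _ _ _ _) ?_ ?_ hf
      fun z s h1 h2 h3 => abs_second_difference_le_omega2 hf h1 h2 h3
    · intro i hi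
      have hi' : (i : ℝ) ≤ n := by exact_mod_cast Nat.lt_succ_iff.1 (Finset.mem_range.1 hi)
      have hin : (i : ℝ) / n ≤ 1 := (div_le_one hn0).2 hi'
      have hk0 : (0 : ℝ) ≤ k - 1 := by linarith
      refine ⟨by positivity, ?_⟩
      rw [← add_div, div_le_one hm0]
      linarith
    · rw [hxy, ← add_div]
      exact div_pos (by linarith) hm0
    · rw [hxy, ← add_div, div_lt_one hm0]
      linarith

theorem pieceIdx_spec {m k : ℕ} (hm : 0 < m) (hk1 : 1 ≤ k) (hk2 : k ≤ m) {x : ℝ}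
    (hx : x ∈ Set.Icc (((k : ℝ) - 1) / (m : ℝ)) ((k : ℝ) / (m : ℝ))) :
    pieceIdx m x = k ∨ (pieceIdx m x = k + 1 ∧ k + 1 ≤ m ∧ x = (k : ℝ) / m) := by
  have hm0 : (0 : ℝ) < m := by positivity
  obtain ⟨hx1, hx2⟩ := hx
  rcases hx2.eq_or_lt with h | h
  · have hmx : (m : ℝ) * x = (k : ℤ) := by rw [h]; push_cast; field_simp
    have hidx : pieceIdx m x = min m (k + 1) := by
      rw [pieceIdx, hmx, Int.floor_intCast, Int.toNat_natCast]
    rcases hk2.eq_or_lt with h' | h'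
    · left
      rw [hidx]
      omega
    · exact Or.inr ⟨by rw [hidx]; omega, h', h⟩
  · left
    rw [div_le_iff₀ hm0] at hx1
    rw [lt_div_iff₀ hm0] at h
    have hfl : ⌊(m : ℝ) * x⌋ = (k : ℤ) - 1 := by
      rw [Int.floor_eq_iff]
      push_cast
      exact ⟨by linarith, by linarith⟩
    rw [pieceIdx, hfl]
    omega

theorem compBernstein_approx
    (n m : ℕ) (hn : 0 < n) (hm : 0 < m) (k : ℕ) (hk1 : 1 ≤ k) (hk2 : k ≤ m)
    (f : ℝ → ℝ) (hf : ContinuousOn f (Set.Icc 0 1))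
    (x : ℝ) (hx : x ∈ Set.Icc (((k : ℝ) - 1) / (m : ℝ)) ((k : ℝ) / (m : ℝ))) :
    |compBernstein n m f x - f x| ≤
      3 / 2 * omega2 0 1 f
        (Real.sqrt ((x - ((k : ℝ) - 1) / (m : ℝ)) * ((k : ℝ) / (m : ℝ) - x) / (n : ℝ))) := by
  rcases pieceIdx_spec hm hk1 hk2 hx with h | ⟨h, hkm, hxk⟩
  · rw [compBernstein, h]
    exact abs_bernsteinPiece_sub_le hn hm hk1 hk2 hf hx
  · have hm0 : (0 : ℝ) < m := by positivity
    have hx' : x ∈ Set.Icc ((((k + 1 : ℕ) : ℝ) - 1) / (m : ℝ)) (((k + 1 : ℕ) : ℝ) / (m : ℝ)) := by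
      push_cast
      rw [hxk, add_sub_cancel_right]
      exact ⟨le_rfl, by gcongr; linarith⟩
    have key := abs_bernsteinPiece_sub_le hn hm (by omega) hkm hf hx'
    rw [compBernstein, h]
    convert key using 4
    push_cast
    rw [hxk]
    ring
end
end

section
/- If H : C[0,1] → C[0,1] is a positive linear operator which reproduces constant functions, then for all f, g ∈ C[0,1] and all x ∈ [0,1], one has |H(f·g; x) - H(f; x)·H(g; x)| ≤ (1/4)·ω̃(f; 2√(H((e₁-x)²; x)))·ω̃(g; 2√(H((e₁-x)²; x))), where e₁(t) = t. -/
open Set Finset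

noncomputable section

/-- First order modulus of continuity for a continuous function on `[0,1]`. -/
def omega1I (f : C(I01, ℝ)) (t : ℝ) : ℝ :=
  sSup {v | ∃ x y : I01, |(x : ℝ) - (y : ℝ)| ≤ t ∧ v = |f x - f y|}

/-- Least concave majorant of the first order modulus of continuity. -/
def omegaTildeI (f : C(I01, ℝ)) (t : ℝ) : ℝ :=
  if t ≤ 1 then
    sSup {v | ∃ x y : ℝ, 0 ≤ x ∧ x ≤ t ∧ t ≤ y ∧ y ≤ 1 ∧ x ≠ y ∧
      v = ((t - x) * omega1I f y + (y - t) * omega1I f x) / (y - x)}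
  else omega1I f 1

theorem bddAbove_omega1I_set (f : C(I01, ℝ)) (t : ℝ) :
    BddAbove {v | ∃ x y : I01, |(x : ℝ) - (y : ℝ)| ≤ t ∧ v = |f x - f y|} := by
  refine ⟨‖f‖ + ‖f‖, ?_⟩
  rintro v ⟨x, y, -, rfl⟩
  exact (abs_sub _ _).trans (add_le_add (f.norm_coe_le_norm x) (f.norm_coe_le_norm y))

theorem abs_sub_le_omega1I (f : C(I01, ℝ)) {t : ℝ} {x y : I01}
    (h : |(x : ℝ) - (y : ℝ)| ≤ t) : |f x - f y| ≤ omega1I f t :=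
  le_csSup (bddAbove_omega1I_set f t) ⟨x, y, h, rfl⟩

theorem omega1I_nonneg (f : C(I01, ℝ)) (t : ℝ) : 0 ≤ omega1I f t := by
  apply Real.sSup_nonneg
  rintro v ⟨x, y, -, rfl⟩
  exact abs_nonneg _

theorem omega1I_mono (f : C(I01, ℝ)) {s t : ℝ} (h : s ≤ t) : omega1I f s ≤ omega1I f t := by
  refine Real.sSup_le ?_ (omega1I_nonneg f t)
  rintro v ⟨x, y, hxy, rfl⟩
  exact abs_sub_le_omega1I f (hxy.trans h)

theorem omega1I_zero (f : C(I01, ℝ)) : omega1I f 0 = 0 := by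
  refine le_antisymm (Real.sSup_le ?_ le_rfl) (omega1I_nonneg f 0)
  rintro v ⟨x, y, hxy, rfl⟩
  have hxy' : x = y := Subtype.ext (sub_eq_zero.1 (abs_nonpos_iff.1 hxy))
  simp [hxy']

theorem chord_le_omegaTildeI (f : C(I01, ℝ)) {x t y : ℝ} (hx : 0 ≤ x) (hxt : x ≤ t)
    (hty : t ≤ y) (hy : y ≤ 1) (hxy : x ≠ y) :
    ((t - x) * omega1I f y + (y - t) * omega1I f x) / (y - x) ≤ omegaTildeI f t := by
  rw [omegaTildeI, if_pos (hty.trans hy)]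
  refine le_csSup ⟨omega1I f 1, ?_⟩ ⟨x, y, hx, hxt, hty, hy, hxy, rfl⟩
  rintro v ⟨a, b, -, hat, htb, hb, hab, rfl⟩
  have hlt : a < b := lt_of_le_of_ne (hat.trans htb) hab
  rw [div_le_iff₀ (sub_pos.2 hlt)]
  nlinarith [mul_le_mul_of_nonneg_left (omega1I_mono f hb) (sub_nonneg.2 hat),
    mul_le_mul_of_nonneg_left (omega1I_mono f (hlt.le.trans hb)) (sub_nonneg.2 htb)]

theorem omegaTildeI_nonneg (f : C(I01, ℝ)) (t : ℝ) : 0 ≤ omegaTildeI f t := by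
  unfold omegaTildeI
  split_ifs
  · apply Real.sSup_nonneg
    rintro v ⟨a, b, -, hat, htb, -, -, rfl⟩
    have h₁ := mul_nonneg (sub_nonneg.2 hat) (omega1I_nonneg f b)
    have h₂ := mul_nonneg (sub_nonneg.2 htb) (omega1I_nonneg f a)
    exact div_nonneg (add_nonneg h₁ h₂) (sub_nonneg.2 (hat.trans htb))
  · exact omega1I_nonneg f 1

/-- At an interior or right end point, the least concave majorant of the modulus of continuity
admits a supporting line with nonnegative slope and intercept. -/
theorem exists_supporting_line (f : C(I01, ℝ)) {t : ℝ} (ht : 0 < t) (ht1 : t ≤ 1) :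
    ∃ a b : ℝ, 0 ≤ a ∧ 0 ≤ b ∧ a + b * t = omegaTildeI f t ∧
      ∀ s, 0 ≤ s → s ≤ 1 → omega1I f s ≤ a + b * s := by
  set S := omegaTildeI f t with hS
  let slope : Ico 0 t → ℝ := fun x => (S - omega1I f x) / (t - x)
  have hle : ∀ x : Ico 0 t, omega1I f x ≤ S := fun x => by
    have hx1 : (x : ℝ) < 1 := x.2.2.trans_le ht1
    refine le_trans ?_ (chord_le_omegaTildeI f x.2.1 x.2.2.le ht1 le_rfl hx1.ne)
    rw [le_div_iff₀ (sub_pos.2 hx1)]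
    nlinarith [mul_le_mul_of_nonneg_left (omega1I_mono f hx1.le) (sub_nonneg.2 x.2.2.le)]
  have hslope : ∀ x, 0 ≤ slope x := fun x =>
    div_nonneg (sub_nonneg.2 (hle x)) (sub_nonneg.2 x.2.2.le)
  have hbdd : BddBelow (Set.range slope) := ⟨0, by rintro _ ⟨x, rfl⟩; exact hslope x⟩
  have : Nonempty (Ico 0 t) := ⟨⟨0, le_rfl, ht⟩⟩
  have hleft : ∀ x, 0 ≤ x → x < t → omega1I f x ≤ S - (⨅ x, slope x) * (t - x) := by
    intro x hx hxt
    have h := ciInf_le hbdd ⟨x, hx, hxt⟩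
    rw [le_div_iff₀ (sub_pos.2 hxt)] at h
    linarith
  refine ⟨S - (⨅ x, slope x) * t, ⨅ x, slope x, ?_, le_ciInf hslope, by ring, ?_⟩
  · simpa [omega1I_zero] using hleft 0 le_rfl ht
  · intro s hs hs1
    rcases lt_trichotomy s t with hst | rfl | hst
    · linarith [hleft s hs hst]
    · have h := chord_le_omegaTildeI f le_rfl hs le_rfl ht1 ht.ne
      rw [sub_self, zero_mul, add_zero, sub_zero, mul_div_cancel_left₀ _ ht.ne'] at h
      linarith
    · have h : (omega1I f s - S) / (s - t) ≤ ⨅ x, slope x := by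
        refine le_ciInf fun x => ?_
        have hxs : (x : ℝ) < s := x.2.2.trans hst
        have h := chord_le_omegaTildeI f x.2.1 x.2.2.le hst.le hs1 hxs.ne
        rw [div_le_iff₀ (sub_pos.2 hxs)] at h
        rw [div_le_div_iff₀ (sub_pos.2 hst) (sub_pos.2 x.2.2)]
        linarith
      rw [div_le_iff₀ (sub_pos.2 hst)] at h
      linarith

theorem exists_affine_bound (f : C(I01, ℝ)) {t : ℝ} (ht : 0 ≤ t) {ε : ℝ} (hε : 0 < ε) :
    ∃ a b : ℝ, 0 ≤ a ∧ 0 ≤ b ∧ a + b * t ≤ omegaTildeI f t + ε ∧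
      ∀ x y : I01, |f x - f y| ≤ a + b * |(x : ℝ) - y| := by
  have hdist : ∀ x y : I01, |(x : ℝ) - y| ≤ 1 := fun x y =>
    abs_le.2 ⟨by linarith [x.2.1, y.2.2], by linarith [x.2.2, y.2.1]⟩
  rcases lt_or_ge 1 t with h1 | h1
  · refine ⟨omega1I f 1, 0, omega1I_nonneg f 1, le_rfl, ?_, fun x y => ?_⟩
    · rw [omegaTildeI, if_neg h1.not_ge]
      linarith
    · simpa using abs_sub_le_omega1I f (hdist x y)
  rcases ht.eq_or_lt with rfl | h0
  · obtain ⟨δ, hδ, h⟩ := Metric.uniformContinuous_iff.1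
      (CompactSpace.uniformContinuous_of_continuous f.continuous) ε hε
    have hb : 0 ≤ omega1I f 1 / δ := div_nonneg (omega1I_nonneg f 1) hδ.le
    refine ⟨ε, omega1I f 1 / δ, hε.le, hb, ?_, fun x y => ?_⟩
    · linarith [omegaTildeI_nonneg f 0]
    · rcases lt_or_ge |(x : ℝ) - y| δ with hxy | hxy
      · have := (h (a := x) (b := y) hxy).le
        rw [Real.dist_eq] at this
        linarith [mul_nonneg hb (abs_nonneg ((x : ℝ) - y))]
      · have h₁ := abs_sub_le_omega1I f (hdist x y)
        have h₂ := mul_le_mul_of_nonneg_left hxy hb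
        rw [div_mul_cancel₀ _ hδ.ne'] at h₂
        linarith
  · obtain ⟨a, b, ha, hb, hab, h⟩ := exists_supporting_line f h0 h1
    exact ⟨a, b, ha, hb, by linarith, fun x y =>
      (abs_sub_le_omega1I f le_rfl).trans (h _ (abs_nonneg _) (hdist x y))⟩

/-- An oscillation bound `a + b * |x - y|` confines `f` to a cone around a single value. -/
theorem exists_center (f : C(I01, ℝ)) {a b : ℝ} (hb : 0 ≤ b)
    (h : ∀ x y : I01, |f x - f y| ≤ a + b * |(x : ℝ) - y|) (x : I01) :
    ∃ c : ℝ, ∀ s : I01, |f s - c| ≤ a / 2 + b * |(s : ℝ) - x| := by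
  have key : ∀ s t : I01,
      f s - (a / 2 + b * |(s : ℝ) - x|) ≤ f t + (a / 2 + b * |(t : ℝ) - x|) := by
    intro s t
    have h₁ := (le_abs_self _).trans (h s t)
    have h₂ := mul_le_mul_of_nonneg_left (abs_sub_le (s : ℝ) x t) hb
    rw [abs_sub_comm (x : ℝ) t] at h₂
    linarith
  have hbdd : BddAbove (Set.range fun s : I01 => f s - (a / 2 + b * |(s : ℝ) - x|)) :=
    ⟨_, by rintro _ ⟨s, rfl⟩; exact key s x⟩
  refine ⟨⨆ s : I01, (f s - (a / 2 + b * |(s : ℝ) - x|)), fun s => ?_⟩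
  have h₁ := le_ciSup hbdd s
  have : Nonempty I01 := ⟨x⟩
  have h₂ := ciSup_le fun t => key t s
  exact abs_le.2 ⟨by linarith, by linarith⟩

section PositiveFunctional

variable {X : Type*} [TopologicalSpace X] {L : C(X, ℝ) →ₗ[ℝ] ℝ}

theorem cauchySchwarz_of_nonneg (hL : ∀ f : C(X, ℝ), (∀ x, 0 ≤ f x) → 0 ≤ L f) (f g : C(X, ℝ)) :
    L (f * g) ^ 2 ≤ L (f * f) * L (g * g) := by
  have h : ∀ r : ℝ, 0 ≤ L (g * g) * (r * r) + 2 * L (f * g) * r + L (f * f) := by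
    intro r
    have h := hL ((f + r • g) * (f + r • g)) fun x => mul_self_nonneg _
    have e : (f + r • g) * (f + r • g) = f * f + (2 * r) • (f * g) + (r * r) • (g * g) := by
      ext x
      simp
      ring
    rw [e] at h
    simp only [map_add, map_smul, smul_eq_mul] at h
    linarith
  have := discrim_le_zero h
  rw [discrim] at this
  linarith

theorem abs_map_mul_le (hL : ∀ f : C(X, ℝ), (∀ x, 0 ≤ f x) → 0 ≤ L f) (f g : C(X, ℝ)) :
    |L (f * g)| ≤ √(L (f * f)) * √(L (g * g)) := by
  rw [← Real.sqrt_mul (hL _ fun x => mul_self_nonneg _)]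
  exact Real.abs_le_sqrt (cauchySchwarz_of_nonneg hL f g)

theorem map_sub_const_mul_sub_const (hL1 : L 1 = 1) (f g : C(X, ℝ)) (c d : ℝ) :
    L ((f - c • 1) * (g - d • 1)) = L (f * g) - L f * L g + (L f - c) * (L g - d) := by
  have e : (f - c • 1) * (g - d • 1) = f * g - d • f - c • g + (c * d) • 1 := by
    ext x
    simp
    ring
  rw [e]
  simp only [map_add, map_sub, map_smul, smul_eq_mul, hL1]
  ring

end PositiveFunctional

theorem sqrt_variance_le {L : C(I01, ℝ) →ₗ[ℝ] ℝ}
    (hL : ∀ f : C(I01, ℝ), (∀ x, 0 ≤ f x) → 0 ≤ L f) (hL1 : L 1 = 1)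
    (f e : C(I01, ℝ)) (x : I01) (he : ∀ t, e t = ((t : ℝ) - x) ^ 2) :
    √(L ((f - L f • 1) * (f - L f • 1))) ≤ 1 / 2 * omegaTildeI f (2 * √(L e)) := by
  refine le_of_forall_pos_le_add fun ε hε => ?_
  set σ := √(L e) with hσ
  have hσ0 : 0 ≤ σ := Real.sqrt_nonneg _
  have hσ2 : σ ^ 2 = L e := Real.sq_sqrt (hL e fun t => by rw [he]; positivity)
  obtain ⟨a, b, ha, hb, hab, h⟩ := exists_affine_bound f (mul_nonneg zero_le_two hσ0) hε
  obtain ⟨c, hc⟩ := exists_center f hb h x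
  let d : C(I01, ℝ) := ⟨fun t => |(t : ℝ) - x|, by fun_prop⟩
  have hdd : d * d = e := by
    ext t
    simp [d, he, sq]
  have hd : L d ≤ σ := by
    have := abs_map_mul_le hL d 1
    rw [mul_one, mul_one, hdd, hL1, Real.sqrt_one, mul_one] at this
    exact (le_abs_self _).trans this
  have hdom : L ((f - c • 1) * (f - c • 1)) ≤ L ((a ^ 2 / 4) • 1 + (a * b) • d + (b ^ 2) • e) := by
    rw [← sub_nonneg, ← map_sub]
    refine hL _ fun t => ?_
    have h₁ := sq_le_sq' (abs_le.1 (hc t)).1 (abs_le.1 (hc t)).2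
    have h₂ := sq_abs ((t : ℝ) - x)
    simp only [ContinuousMap.sub_apply, ContinuousMap.add_apply, ContinuousMap.smul_apply,
      ContinuousMap.mul_apply, ContinuousMap.one_apply, smul_eq_mul, he, d, ContinuousMap.coe_mk]
    rw [← h₂]
    nlinarith
  have hvar : L ((f - L f • 1) * (f - L f • 1)) ≤ (a / 2 + b * σ) ^ 2 := by
    have h₁ := map_sub_const_mul_sub_const hL1 f f c c
    have h₂ := map_sub_const_mul_sub_const hL1 f f (L f) (L f)
    simp only [map_add, map_smul, smul_eq_mul, hL1, ← hσ2] at hdom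
    nlinarith [mul_le_mul_of_nonneg_left hd (mul_nonneg ha hb), mul_self_nonneg (L f - c)]
  have := Real.sqrt_le_sqrt hvar
  rw [Real.sqrt_sq (by positivity)] at this
  linarith

theorem gruss_positive_operator
    (H : C(I01, ℝ) →ₗ[ℝ] C(I01, ℝ))
    (hpos : ∀ f : C(I01, ℝ), (∀ x, 0 ≤ f x) → ∀ x, 0 ≤ H f x)
    (hconst : ∀ c : ℝ, H (ContinuousMap.const I01 c) = ContinuousMap.const I01 c)
    (f g : C(I01, ℝ)) (x : I01) :
    |H (f * g) x - H f x * H g x| ≤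
      1 / 4 *
        omegaTildeI f (2 * Real.sqrt
          (H (ContinuousMap.mk (fun t : I01 => ((t : ℝ) - (x : ℝ)) ^ 2) (by fun_prop)) x)) *
        omegaTildeI g (2 * Real.sqrt
          (H (ContinuousMap.mk (fun t : I01 => ((t : ℝ) - (x : ℝ)) ^ 2) (by fun_prop)) x)) := by
  let L : C(I01, ℝ) →ₗ[ℝ] ℝ := (ContinuousMap.evalCLM ℝ x).toLinearMap ∘ₗ H
  have hL : ∀ f : C(I01, ℝ), (∀ x, 0 ≤ f x) → 0 ≤ L f := fun f hf => hpos f hf x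
  have hL1 : L 1 = 1 := congrArg (fun k : C(I01, ℝ) => k x) (hconst 1)
  set e : C(I01, ℝ) := ContinuousMap.mk (fun t : I01 => ((t : ℝ) - (x : ℝ)) ^ 2) (by fun_prop)
  have hcov := map_sub_const_mul_sub_const hL1 f g (L f) (L g)
  rw [sub_self, zero_mul, add_zero] at hcov
  have hf := sqrt_variance_le hL hL1 f e x fun _ => rfl
  have hg := sqrt_variance_le hL hL1 g e x fun _ => rfl
  change |L (f * g) - L f * L g| ≤
    1 / 4 * omegaTildeI f (2 * √(L e)) * omegaTildeI g (2 * √(L e))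
  calc |L (f * g) - L f * L g| = |L ((f - L f • 1) * (g - L g • 1))| := by rw [hcov]
    _ ≤ √(L ((f - L f • 1) * (f - L f • 1))) * √(L ((g - L g • 1) * (g - L g • 1))) :=
      abs_map_mul_le hL _ _
    _ ≤ (1 / 2 * omegaTildeI f (2 * √(L e))) * (1 / 2 * omegaTildeI g (2 * √(L e))) :=
      mul_le_mul hf hg (Real.sqrt_nonneg _) ((Real.sqrt_nonneg _).trans hf)
    _ = 1 / 4 * omegaTildeI f (2 * √(L e)) * omegaTildeI g (2 * √(L e)) := by ring
end
end
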